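/- Let F be a finite field, let q ≥ 2, M ≥ 1, k ≥ 2 be natural numbers, let K and H be natural numbers with 1 ≤ K ≤ k−1 and 1 ≤ H ≤ M, let x₁,…,x_K ∈ F and γ₁,…,γ_H ∈ F. Let X be the K×k matrix whose i-th row is (1, xᵢ, xᵢ², …, xᵢ^(k−1)), and let Γ be the (M+1)×H matrix whose h-th column is (1, γₕ, γₕ^q, γₕ^(q²), …, γₕ^(q^(M−1)))ᵀ. Then the set of k×(M+1) matrices A with entries in F satisfying X·A = 0 and A·Γ = 0 has cardinality at least |F|, the number of elements of F. -/

import Mathlib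

/-- A matrix over a field with fewer rows than columns has a nonzero vector in its kernel. -/
theorem exists_ne_zero_mulVec_eq_zero_of_card_lt {F m n : Type*} [Field F] [Fintype m] [Fintype n]
    (B : Matrix m n F) (h : Fintype.card m < Fintype.card n) :
    ∃ v : n → F, v ≠ 0 ∧ B.mulVec v = 0 := by
  have hker : LinearMap.ker B.mulVecLin ≠ ⊥ :=
    LinearMap.ker_ne_bot_of_finrank_lt (by simpa using h)
  obtain ⟨v, hv, hv0⟩ := (Submodule.ne_bot_iff _).1 hker
  exact ⟨v, hv0, by simpa using hv⟩

/-- If `B` has fewer rows than columns and `C` has fewer columns than rows, then the system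
`B * A = 0`, `A * C = 0` has a nonzero solution. -/
theorem exists_ne_zero_mul_eq_zero_and_mul_eq_zero {F l m n p : Type*} [Field F]
    [Fintype l] [Fintype m] [Fintype n] [Fintype p] (B : Matrix l m F) (C : Matrix n p F)
    (hB : Fintype.card l < Fintype.card m) (hC : Fintype.card p < Fintype.card n) :
    ∃ A : Matrix m n F, A ≠ 0 ∧ B * A = 0 ∧ A * C = 0 := by
  obtain ⟨u, hu0, hu⟩ := exists_ne_zero_mulVec_eq_zero_of_card_lt B hB
  obtain ⟨v, hv0, hv⟩ := exists_ne_zero_mulVec_eq_zero_of_card_lt C.transpose hC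
  rw [Matrix.mulVec_transpose] at hv
  refine ⟨Matrix.vecMulVec u v, ?_, ?_, ?_⟩
  · obtain ⟨i, hi⟩ := Function.ne_iff.1 hu0
    obtain ⟨j, hj⟩ := Function.ne_iff.1 hv0
    intro h
    exact mul_ne_zero hi hj (by simpa [Matrix.vecMulVec_apply] using congrFun (congrFun h i) j)
  · rw [Matrix.mul_vecMulVec, hu, Matrix.zero_vecMulVec]
  · rw [Matrix.vecMulVec_mul, hv]
    ext i j
    simp [Matrix.vecMulVec_apply]

/-- Lemma 3 of the paper: over a finite field F, the homogeneous system X·A = 0,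
A·Γ = 0 (with X the K×k Vandermonde matrix, K ≤ k-1, and Γ the (M+1)×H q-power
Vandermonde matrix, H ≤ M) has at least |F| solutions A. -/
theorem stmt4 (F : Type*) [Field F] [Fintype F] (q M k K H : ℕ) (hq : 2 ≤ q)
    (hM : 1 ≤ M) (hk : 2 ≤ k) (hK1 : 1 ≤ K) (hKk : K ≤ k - 1) (hH1 : 1 ≤ H) (hHM : H ≤ M)
    (x : Fin K → F) (γ : Fin H → F)
    (X : Matrix (Fin K) (Fin k) F) (hX : ∀ i m, X i m = x i ^ (m : ℕ))
    (Γ : Matrix (Fin (M + 1)) (Fin H) F)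
    (hΓ : ∀ m h, Γ m h = if (m : ℕ) = 0 then 1 else γ h ^ q ^ ((m : ℕ) - 1)) :
    Fintype.card F ≤
      Nat.card {A : Matrix (Fin k) (Fin (M + 1)) F // X * A = 0 ∧ A * Γ = 0} := by
  obtain ⟨A, hA0, hXA, hAΓ⟩ := exists_ne_zero_mul_eq_zero_and_mul_eq_zero X Γ
    (by simp only [Fintype.card_fin]; omega) (by simp only [Fintype.card_fin]; omega)
  rw [← Nat.card_eq_fintype_card]
  refine Nat.card_le_card_of_injective
    (fun c : F => ⟨c • A, by rw [Matrix.mul_smul, hXA, smul_zero],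
      by rw [Matrix.smul_mul, hAΓ, smul_zero]⟩) ?_
  intro c d hcd
  exact smul_left_injective F hA0 (congrArg Subtype.val hcd)
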